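/- For every integer i ≥ 2 and every real number a with a ≥ i and a ≥ 2, the magnitude of the last coefficient in the expansions of t_{i0} and t_i is dominated as follows: 4^i < a²·|d_{i,i−1}| and 4^i < a²·|e_{i,i−1}|, where d_{i,i−1} and e_{i,i−1} are the coefficients of a^{−(2i−1)} in t_{i0} and t_i respectively. (Equivalently, |d_{i,i}| < a²·|d_{i,i−1}| and |e_{i,i}| < a²·|e_{i,i−1}|.) -/

import Mathlib

open Polynomial in
/-- The pair `(P, Q)` of polynomials with `t_{i0} = P(1/a²)/a` and `t_i = Q(1/a²)/a`. -/
noncomputable def groverPoly : ℕ → ℝ[X] × ℝ[X]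
  | 0 => (1, 1)
  | i + 1 =>
    let p := groverPoly i
    (p.1 + C 2 * p.2 - C 2 * ((p.1 + p.2) * X), p.2 - C 2 * ((p.1 + p.2) * X))

lemma groverPoly_coeff_eq_zero (i : ℕ) : ∀ k, i < k →
    (groverPoly i).1.coeff k = 0 ∧ (groverPoly i).2.coeff k = 0 := by
  induction i with
  | zero =>
    intro k hk
    simp [groverPoly, Polynomial.coeff_one, hk.ne']
  | succ i ih =>
    rintro (_ | k) hk
    · omega
    · have h1 := ih k (by omega)
      have h2 := ih (k + 1) (by omega)
      simp [groverPoly, Polynomial.coeff_mul_X, h1, h2]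

lemma groverPoly_coeff_top (n : ℕ) :
    (groverPoly (n + 1)).1.coeff (n + 1) = (-4) ^ (n + 1) ∧
    (groverPoly (n + 1)).2.coeff (n + 1) = (-4) ^ (n + 1) := by
  induction n with
  | zero => simp [groverPoly, Polynomial.coeff_one]; norm_num
  | succ n ih =>
    have h := groverPoly_coeff_eq_zero (n + 1) (n + 2) (by omega)
    rw [groverPoly]
    simp only [Polynomial.coeff_add, Polynomial.coeff_sub, Polynomial.coeff_C_mul,
      Polynomial.coeff_mul_X, ih, h]
    constructor <;> ring

lemma groverPoly_coeff_pred (n : ℕ) :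
    (groverPoly (n + 1)).1.coeff n = (2 * n + 3) * (-4) ^ n ∧
    (groverPoly (n + 1)).2.coeff n = (2 * n + 1) * (-4) ^ n := by
  induction n with
  | zero => simp [groverPoly]; norm_num
  | succ n ih =>
    have h := groverPoly_coeff_top n
    rw [groverPoly]
    simp only [Polynomial.coeff_add, Polynomial.coeff_sub, Polynomial.coeff_C_mul,
      Polynomial.coeff_mul_X, ih, h]
    push_cast
    constructor <;> ring

lemma eq_groverPoly_eval {b : ℝ} {t t0 : ℕ → ℝ} (hinit : t 0 = 1 / b ∧ t0 0 = 1 / b)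
    (hrec0 : ∀ i, t0 (i + 1) = -2 * t0 i / b ^ 2 - 2 * t i / b ^ 2 + 2 * t i + t0 i)
    (hrec : ∀ i, t (i + 1) = -2 * t0 i / b ^ 2 - 2 * t i / b ^ 2 + t i) (i : ℕ) :
    t0 i = (groverPoly i).1.eval (b ^ 2)⁻¹ * b⁻¹ ∧
    t i = (groverPoly i).2.eval (b ^ 2)⁻¹ * b⁻¹ := by
  induction i with
  | zero => simp [groverPoly, hinit]
  | succ i ih =>
    rw [hrec0, hrec, ih.1, ih.2, groverPoly]
    simp only [Polynomial.eval_add, Polynomial.eval_sub, Polynomial.eval_mul,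
      Polynomial.eval_C, Polynomial.eval_X]
    constructor <;> ring

/-- The coefficients of an expansion in odd negative powers are unique. -/
lemma coeff_eq_of_eval_inv_sq_eq {p : Polynomial ℝ} {n : ℕ} {c : ℕ → ℝ}
    (h : ∀ b : ℝ, b ≠ 0 → p.eval (b ^ 2)⁻¹ * b⁻¹ =
      ∑ j ∈ Finset.range n, c j * b ^ (-(2 * (j : ℤ) + 1)))
    {k : ℕ} (hk : k < n) : p.coeff k = c k := by
  have hp : p = ∑ j ∈ Finset.range n, Polynomial.C (c j) * Polynomial.X ^ j := by
    refine Polynomial.eq_of_infinite_eval_eq _ _ ((Set.Ioi_infinite (0 : ℝ)).mono ?_)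
    intro u (hu : 0 < u)
    have hb : (√u)⁻¹ ≠ 0 := inv_ne_zero (Real.sqrt_pos.2 hu).ne'
    have hsq : (((√u)⁻¹) ^ 2)⁻¹ = u := by rw [inv_pow, inv_inv, Real.sq_sqrt hu.le]
    have hu' := h _ hb
    have hpow (j : ℕ) : ((√u)⁻¹) ^ (-(2 * (j : ℤ) + 1)) = u ^ j * ((√u)⁻¹)⁻¹ := by
      rw [zpow_neg, zpow_add_one₀ hb, zpow_mul, mul_inv, zpow_natCast, ← inv_pow,
        zpow_ofNat, hsq]
    simp only [hpow, hsq, ← mul_assoc, ← Finset.sum_mul] at hu'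
    simpa [Polynomial.eval_finsetSum] using mul_right_cancel₀ (inv_ne_zero hb) hu'
  rw [hp]
  simp [Polynomial.finsetSum_coeff, Polynomial.coeff_X_pow, hk]

lemma four_pow_lt_sq_mul_abs {a m : ℝ} (ha : 2 ≤ a) (hm : 1 < m) (n : ℕ) :
    (4 : ℝ) ^ (n + 1) < a ^ 2 * |m * (-4) ^ n| := by
  rw [abs_mul, abs_pow, abs_neg, abs_of_pos (by linarith : 0 < m),
    abs_of_pos (by norm_num : (0 : ℝ) < 4), pow_succ', ← mul_assoc]
  have h : (4 : ℝ) ≤ a ^ 2 := by nlinarith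
  gcongr
  nlinarith

/-- Lemma 3 of the paper: for `i ≥ 2` and real `a ≥ i`, `a ≥ 2`,
the magnitude `4^i` of the last coefficient in the expansions of `t_{i0}` and
`t_i` is dominated by `a²` times the magnitude of the preceding coefficient:
`4^i < a² |d_{i,i-1}|` and `4^i < a² |e_{i,i-1}|`. -/
theorem grover_last_coefficient_dominated
    (T T0 : ℝ → ℕ → ℝ)
    (hinit : ∀ a : ℝ, a ≠ 0 → T a 0 = 1 / a ∧ T0 a 0 = 1 / a)
    (hrec0 : ∀ a : ℝ, a ≠ 0 → ∀ i,
      T0 a (i + 1) = -2 * T0 a i / a ^ 2 - 2 * T a i / a ^ 2 + 2 * T a i + T0 a i)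
    (hrec : ∀ a : ℝ, a ≠ 0 → ∀ i,
      T a (i + 1) = -2 * T0 a i / a ^ 2 - 2 * T a i / a ^ 2 + T a i)
    (i : ℕ) (hi : 2 ≤ i)
    (d e : ℕ → ℚ)
    (hd : ∀ b : ℝ, b ≠ 0 →
      T0 b i = ∑ j ∈ Finset.range (i + 1), (d j : ℝ) * b ^ (-(2 * (j : ℤ) + 1)))
    (he : ∀ b : ℝ, b ≠ 0 →
      T b i = ∑ j ∈ Finset.range (i + 1), (e j : ℝ) * b ^ (-(2 * (j : ℤ) + 1)))
    (a : ℝ) (hai : (i : ℝ) ≤ a) (ha2 : 2 ≤ a) :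
    (4 : ℝ) ^ i < a ^ 2 * |(d (i - 1) : ℝ)| ∧
      (4 : ℝ) ^ i < a ^ 2 * |(e (i - 1) : ℝ)| := by
  have key (b : ℝ) (hb : b ≠ 0) :=
    eq_groverPoly_eval (hinit b hb) (hrec0 b hb) (hrec b hb) i
  have hdc := coeff_eq_of_eval_inv_sq_eq
    (fun b hb => (key b hb).1.symm.trans (hd b hb)) (by omega : i - 1 < i + 1)
  have hec := coeff_eq_of_eval_inv_sq_eq
    (fun b hb => (key b hb).2.symm.trans (he b hb)) (by omega : i - 1 < i + 1)
  obtain ⟨n, rfl⟩ : ∃ n, i = n + 1 := ⟨i - 1, by omega⟩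
  have hn : (1 : ℝ) ≤ n := by exact_mod_cast (by omega : 1 ≤ n)
  rw [Nat.add_sub_cancel] at hdc hec ⊢
  rw [← hdc, ← hec, (groverPoly_coeff_pred n).1, (groverPoly_coeff_pred n).2]
  exact ⟨four_pow_lt_sq_mul_abs ha2 (by linarith) n, four_pow_lt_sq_mul_abs ha2 (by linarith) n⟩
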